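/- Let d ≥ 1, α > 0, τ > 0, and let λ ∈ (−1, 1) with λ ≠ 0. Let ξ₁, …, ξ_d be i.i.d. standard real Gaussian random variables. Then E[log((1 + αλτ ξ₁)² + α²λ²τ²(ξ₂² + ⋯ + ξ_d²))] > 2 log|λ| + E[log((1 + ατ ξ₁)² + α²τ²(ξ₂² + ⋯ + ξ_d²))]. -/

import Mathlib

open MeasureTheory ProbabilityTheory

/-- `E[log ((1 + c ξ₁)² + c² (ξ₂² + ⋯ + ξ_d²))]` for i.i.d. standard real Gaussians
`ξ₁, …, ξ_d`. -/
noncomputable def gaussExpLog (d : ℕ) (c : ℝ) : ℝ :=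
  ∫ p : ℝ × (Fin (d - 1) → ℝ),
    Real.log ((1 + c * p.1) ^ 2 + c ^ 2 * ∑ i, (p.2 i) ^ 2)
    ∂((gaussianReal 0 1).prod (Measure.pi fun _ => gaussianReal 0 1))

lemma integral_pos_of_ae_pos {Ω : Type*} [MeasurableSpace Ω] {μ : Measure Ω} [NeZero μ]
    {f : Ω → ℝ} (hf : Integrable f μ) (hpos : ∀ᵐ x ∂μ, 0 < f x) : 0 < ∫ x, f x ∂μ := by
  rw [integral_pos_iff_support_of_nonneg_ae (hpos.mono fun _ h => h.le) hf, pos_iff_ne_zero]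
  intro hzero
  have hfalse : ∀ᵐ x ∂μ, False := by
    filter_upwards [hpos, measure_eq_zero_iff_ae_notMem.1 hzero] with x hx hx'
    exact hx' hx.ne'
  exact NeZero.ne μ (ae_eq_bot.1 (Filter.eventually_false_iff_eq_bot.1 hfalse))

lemma abs_log_sq_add_le {x r : ℝ} (hx : x ≠ 0) (hr : 0 ≤ r) :
    |Real.log (x ^ 2 + r)| ≤ x ^ 2 + r + 2 * |Real.log x| := by
  have hx2 : 0 < x ^ 2 := by positivity
  have hupper := Real.log_le_sub_one_of_pos (show 0 < x ^ 2 + r by positivity)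
  have hlower : Real.log (x ^ 2) ≤ Real.log (x ^ 2 + r) := Real.log_le_log hx2 (by linarith)
  rw [Real.log_pow] at hlower
  push_cast at hlower
  rw [abs_le]
  constructor <;> linarith [neg_abs_le (Real.log x), abs_nonneg (Real.log x)]

lemma integrable_gaussianReal_iff {f : ℝ → ℝ} (m : ℝ) :
    Integrable f (gaussianReal m 1) ↔ Integrable (fun x => gaussianPDFReal m 1 x * f x) := by
  rw [gaussianReal_of_var_ne_zero m one_ne_zero,
    integrable_withDensity_iff_integrable_smul' (measurable_gaussianPDF m 1)
      (ae_of_all _ fun _ => gaussianPDF_lt_top)]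
  simp only [toReal_gaussianPDF, smul_eq_mul]

lemma integrable_sq_gaussianReal (m : ℝ) : Integrable (fun x => x ^ 2) (gaussianReal m 1) :=
  (memLp_id_gaussianReal' 2 (by simp)).integrable_sq

lemma integrable_log_gaussianReal (m : ℝ) : Integrable Real.log (gaussianReal m 1) := by
  have hlocal : Integrable ((Set.Ioc (-1) 1).indicator Real.log) (gaussianReal m 1) := by
    rw [integrable_gaussianReal_iff]
    refine Integrable.bdd_mul (c := (√(2 * Real.pi * (1 : NNReal)))⁻¹) ?_
      (measurable_gaussianPDFReal m 1).aestronglyMeasurable (ae_of_all _ fun x => ?_)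
    · rw [integrable_indicator_iff measurableSet_Ioc]
      exact (intervalIntegrable_iff_integrableOn_Ioc_of_le (by norm_num)).1
        intervalIntegral.intervalIntegrable_log'
    · rw [Real.norm_of_nonneg (gaussianPDFReal_nonneg m 1 x), gaussianPDFReal]
      refine mul_le_of_le_one_right (by positivity) (Real.exp_le_one_iff.2 ?_)
      exact div_nonpos_of_nonpos_of_nonneg (neg_nonpos.2 (sq_nonneg _)) (by positivity)
  refine Integrable.mono' ((integrable_sq_gaussianReal m).add hlocal.abs)
    Real.measurable_log.aestronglyMeasurable (ae_of_all _ fun x => ?_)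
  simp only [Pi.add_apply, Real.norm_eq_abs]
  by_cases hx : x ∈ Set.Ioc (-1 : ℝ) 1
  · rw [Set.indicator_of_mem hx]
    linarith [sq_nonneg x]
  · rw [Set.indicator_of_notMem hx, abs_zero, add_zero]
    have hx1 : 1 ≤ |x| := by
      by_contra! h
      exact hx ⟨(abs_lt.1 h).1, (abs_lt.1 h).2.le⟩
    rw [← Real.log_abs, abs_of_nonneg (Real.log_nonneg hx1), ← sq_abs]
    nlinarith [Real.log_le_sub_one_of_pos (show 0 < |x| by linarith)]

lemma integrable_log_sq_add_gaussianReal (m : ℝ) {r : ℝ} (hr : 0 ≤ r) :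
    Integrable (fun x => Real.log (x ^ 2 + r)) (gaussianReal m 1) := by
  refine Integrable.mono' (((integrable_sq_gaussianReal m).add (integrable_const r)).add
    ((integrable_log_gaussianReal m).abs.const_mul 2)) (Real.measurable_log.comp (by fun_prop)).aestronglyMeasurable ?_
  have : NullSingletonClass (gaussianReal m 1) := nullSingletonClass_gaussianReal one_ne_zero
  filter_upwards [Measure.ae_ne (gaussianReal m 1) 0] with x hx
  exact abs_log_sq_add_le hx hr

lemma integral_log_sq_add_gaussianReal_lt {s t r : ℝ} (hst : s ^ 2 < t ^ 2) (hr : 0 ≤ r) :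
    ∫ x, Real.log (x ^ 2 + r) ∂gaussianReal s 1 < ∫ x, Real.log (x ^ 2 + r) ∂gaussianReal t 1 := by
  set φ : ℝ → ℝ := fun x => Real.log (x ^ 2 + r)
  set p := gaussianPDFReal s 1 with hp
  set q := gaussianPDFReal t 1 with hq
  have hp_reflect (x : ℝ) : p (s + t - x) = q x := by
    simp only [hp, hq, gaussianPDFReal]
    congr 3
    ring
  have hq_reflect (x : ℝ) : q (s + t - x) = p x := by
    simp only [hp, hq, gaussianPDFReal]
    congr 3
    ring
  have hip : Integrable fun x => p x * φ x :=
    (integrable_gaussianReal_iff s).1 (integrable_log_sq_add_gaussianReal s hr)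
  have hiq : Integrable fun x => q x * φ x :=
    (integrable_gaussianReal_iff t).1 (integrable_log_sq_add_gaussianReal t hr)
  have hip' : Integrable fun x => q x * φ (s + t - x) := by
    simpa only [hp_reflect] using hip.comp_sub_left (s + t)
  have hiq' : Integrable fun x => p x * φ (s + t - x) := by
    simpa only [hq_reflect] using hiq.comp_sub_left (s + t)
  have hep : ∫ x, q x * φ (s + t - x) = ∫ x, p x * φ x := by
    simpa only [hp_reflect] using integral_sub_left_eq_self (fun x => p x * φ x) volume (s + t)
  have heq : ∫ x, p x * φ (s + t - x) = ∫ x, q x * φ x := by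
    simpa only [hq_reflect] using integral_sub_left_eq_self (fun x => q x * φ x) volume (s + t)
  have hpos : ∀ᵐ x, 0 < (q x * φ x - p x * φ x) - (q x * φ (s + t - x) - p x * φ (s + t - x)) := by
    filter_upwards [Measure.ae_ne volume 0, Measure.ae_ne volume (s + t),
      Measure.ae_ne volume ((s + t) / 2)] with x hx0 hx1 hx2
    have hx1' : s + t - x ≠ 0 := fun h => hx1 (by linarith)
    have hsign : 0 < (x ^ 2 - (s + t - x) ^ 2) * ((x - s) ^ 2 - (x - t) ^ 2) := by
      have : (x ^ 2 - (s + t - x) ^ 2) * ((x - s) ^ 2 - (x - t) ^ 2)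
          = 4 * (t ^ 2 - s ^ 2) * (x - (s + t) / 2) ^ 2 := by ring
      rw [this]
      have := sub_ne_zero.2 hx2
      have := sub_pos.2 hst
      positivity
    have hfactor : (q x * φ x - p x * φ x) - (q x * φ (s + t - x) - p x * φ (s + t - x))
        = (φ x - φ (s + t - x)) * (q x - p x) := by ring
    rw [hfactor]
    have hpdf {a b : ℝ} (hab : (x - b) ^ 2 < (x - a) ^ 2) :
        gaussianPDFReal a 1 x < gaussianPDFReal b 1 x := by
      simp only [gaussianPDFReal]
      gcongr
    rcases mul_pos_iff.1 hsign with ⟨h1, h2⟩ | ⟨h1, h2⟩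
    · exact mul_pos (sub_pos.2 (Real.log_lt_log (by positivity) (by linarith)))
        (sub_pos.2 (hpdf (by linarith)))
    · exact mul_pos_of_neg_of_neg (sub_neg.2 (Real.log_lt_log (by positivity) (by linarith)))
        (sub_neg.2 (hpdf (by linarith)))
  have hint := (hiq.sub hip).sub (hip'.sub hiq')
  have hlt := integral_pos_of_ae_pos hint hpos
  rw [integral_gaussianReal_eq_integral_smul one_ne_zero,
    integral_gaussianReal_eq_integral_smul one_ne_zero]
  simp only [smul_eq_mul]
  have := integral_sub (hiq.sub hip) (hip'.sub hiq')
  have := integral_sub hiq hip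
  have := integral_sub hip' hiq'
  simp only [Pi.sub_apply] at *
  linarith

lemma integral_gaussianReal_add {f : ℝ → ℝ} (s : ℝ) :
    ∫ x, f (s + x) ∂gaussianReal 0 1 = ∫ x, f x ∂gaussianReal s 1 := by
  have h := gaussianReal_map_const_add (μ := 0) (v := 1) s
  rw [zero_add] at h
  rw [← h, (measurableEmbedding_addLeft s).integral_map]

lemma integrable_log_sq_gaussian_prod {n : ℕ} (s : ℝ) :
    Integrable (fun z : ℝ × (Fin n → ℝ) => Real.log ((s + z.1) ^ 2 + ∑ i, z.2 i ^ 2))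
      ((gaussianReal 0 1).prod (Measure.pi fun _ => gaussianReal 0 1)) := by
  have hsum : Integrable (fun y : Fin n → ℝ => ∑ i, y i ^ 2)
      (Measure.pi fun _ => gaussianReal 0 1) :=
    integrable_finsetSum _ fun i _ =>
      integrable_comp_eval (μ := fun _ : Fin n => gaussianReal 0 1) (i := i)
        (f := fun x : ℝ => x ^ 2) (integrable_sq_gaussianReal 0)
  have hshift {f : ℝ → ℝ} (hf : Integrable f (gaussianReal s 1)) :
      Integrable (fun x => f (s + x)) (gaussianReal 0 1) := by
    have h := gaussianReal_map_const_add (μ := 0) (v := 1) s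
    rw [zero_add] at h
    rwa [← h, (measurableEmbedding_addLeft s).integrable_map_iff] at hf
  have hsq := (hshift (integrable_sq_gaussianReal s)).comp_fst
    (Measure.pi fun _ : Fin n => gaussianReal 0 1)
  have hlog := (hshift (integrable_log_gaussianReal s)).comp_fst
    (Measure.pi fun _ : Fin n => gaussianReal 0 1)
  refine Integrable.mono' ((hsq.add (hsum.comp_snd (gaussianReal 0 1))).add
    (hlog.abs.const_mul 2)) (Real.measurable_log.comp (by fun_prop)).aestronglyMeasurable ?_
  have : NullSingletonClass (gaussianReal 0 1) := nullSingletonClass_gaussianReal one_ne_zero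
  filter_upwards [Measure.quasiMeasurePreserving_fst.ae (Measure.ae_ne (gaussianReal 0 1) (-s))]
    with z hz
  exact abs_log_sq_add_le (fun h => hz (by linarith)) (Finset.sum_nonneg fun i _ => sq_nonneg _)

lemma integral_log_sq_gaussian_prod_lt {n : ℕ} {s t : ℝ} (hst : s ^ 2 < t ^ 2) :
    ∫ z : ℝ × (Fin n → ℝ), Real.log ((s + z.1) ^ 2 + ∑ i, z.2 i ^ 2)
        ∂((gaussianReal 0 1).prod (Measure.pi fun _ => gaussianReal 0 1))
      < ∫ z : ℝ × (Fin n → ℝ), Real.log ((t + z.1) ^ 2 + ∑ i, z.2 i ^ 2)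
        ∂((gaussianReal 0 1).prod (Measure.pi fun _ => gaussianReal 0 1)) := by
  have his := integrable_log_sq_gaussian_prod (n := n) s
  have hit := integrable_log_sq_gaussian_prod (n := n) t
  rw [integral_prod_symm _ his, integral_prod_symm _ hit, ← sub_pos,
    ← integral_sub hit.integral_prod_right his.integral_prod_right]
  refine integral_pos_of_ae_pos (hit.integral_prod_right.sub his.integral_prod_right)
    (ae_of_all _ fun y => ?_)
  rw [sub_pos, integral_gaussianReal_add (f := fun x => Real.log (x ^ 2 + ∑ i, y i ^ 2)),
    integral_gaussianReal_add (f := fun x => Real.log (x ^ 2 + ∑ i, y i ^ 2))]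
  exact integral_log_sq_add_gaussianReal_lt hst (Finset.sum_nonneg fun i _ => sq_nonneg _)

lemma gaussExpLog_eq {d : ℕ} {c : ℝ} (hc : c ≠ 0) :
    gaussExpLog d c = 2 * Real.log |c| +
      ∫ z : ℝ × (Fin (d - 1) → ℝ), Real.log ((c⁻¹ + z.1) ^ 2 + ∑ i, z.2 i ^ 2)
        ∂((gaussianReal 0 1).prod (Measure.pi fun _ => gaussianReal 0 1)) := by
  have hconst : 2 * Real.log |c| = ∫ _ : ℝ × (Fin (d - 1) → ℝ), 2 * Real.log |c|
      ∂((gaussianReal 0 1).prod (Measure.pi fun _ => gaussianReal 0 1)) := by simp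
  rw [hconst, ← integral_add (integrable_const _) (integrable_log_sq_gaussian_prod c⁻¹),
    gaussExpLog]
  refine integral_congr_ae ?_
  have : NullSingletonClass (gaussianReal 0 1) := nullSingletonClass_gaussianReal one_ne_zero
  filter_upwards [Measure.quasiMeasurePreserving_fst.ae (Measure.ae_ne (gaussianReal 0 1) (-c⁻¹))]
    with z hz
  have hz' : c⁻¹ + z.1 ≠ 0 := fun h => hz (by linarith)
  have hsum : 0 ≤ ∑ i, z.2 i ^ 2 := Finset.sum_nonneg fun i _ => sq_nonneg _
  have hfactor : (1 + c * z.1) ^ 2 + c ^ 2 * ∑ i, z.2 i ^ 2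
      = c ^ 2 * ((c⁻¹ + z.1) ^ 2 + ∑ i, z.2 i ^ 2) := by
    field_simp
  rw [hfactor, Real.log_mul (by positivity) (by positivity), Real.log_pow, Real.log_abs]
  norm_num

theorem stmt18 {d : ℕ} (hd : 1 ≤ d) (α τ : ℝ) (hα : 0 < α) (hτ : 0 < τ)
    (lam : ℝ) (hlam : lam ∈ Set.Ioo (-1 : ℝ) 1) (hlam0 : lam ≠ 0) :
    2 * Real.log |lam| + gaussExpLog d (α * τ) < gaussExpLog d (α * lam * τ) := by
  have hc : 0 < α * τ := mul_pos hα hτ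
  have hlt : ((α * τ)⁻¹) ^ 2 < ((lam * (α * τ))⁻¹) ^ 2 := by
    have hmul : (lam * (α * τ)) ^ 2 < (α * τ) ^ 2 := by
      rw [mul_pow]
      exact mul_lt_of_lt_one_left (by positivity) ((sq_lt_one_iff_abs_lt_one lam).2 (abs_lt.2 hlam))
    rw [inv_pow, inv_pow]
    exact inv_strictAnti₀ (by positivity) hmul
  rw [show α * lam * τ = lam * (α * τ) by ring, gaussExpLog_eq hc.ne',
    gaussExpLog_eq (mul_ne_zero hlam0 hc.ne'), abs_mul lam,
    Real.log_mul (abs_ne_zero.2 hlam0) (abs_ne_zero.2 hc.ne')]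
  linarith [integral_log_sq_gaussian_prod_lt (n := d - 1) hlt]
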